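/- arXiv:1604.08150 — 5 statements merged into one kernel-verified Lean document; each statement's English description precedes it below -/
import Mathlib

section
/- Let X and Y be types, let f : X ≃ X and g : Y ≃ Y be bijections, and let m, n, c, d be integers with f^m = id, g^n = id, and m·c + n·d = 1. Let S be any type and define h : S × X × Y ≃ S × X × Y by h(s, x, y) = (s, f^(-d)(x), g^c(y)). Then h^(m-n)(s, x, y) = (s, f(x), g(y)) for all (s, x, y). -/
theorem prodCongr_zpow_aux {A B : Type*} (a : Equiv.Perm A) (b : Equiv.Perm B) (k : ℤ) :
    ((Equiv.prodCongr a b : Equiv.Perm (A × B)) ^ k) = Equiv.prodCongr (a ^ k) (b ^ k) := by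
  let φ : Equiv.Perm A × Equiv.Perm B →* Equiv.Perm (A × B) :=
    { toFun := fun p => Equiv.prodCongr p.1 p.2
      map_one' := by ext x <;> rfl
      map_mul' := by intro p q; ext x <;> rfl }
  exact (map_zpow φ (a, b) k).symm

theorem equiv_pow_m_sub_n {X Y S : Type*} (f : X ≃ X) (g : Y ≃ Y) (m n c d : ℤ)
    (hf : f ^ m = Equiv.refl X) (hg : g ^ n = Equiv.refl Y)
    (hbezout : m * c + n * d = 1) :
    ∀ s : S, ∀ x : X, ∀ y : Y,
      (((Equiv.refl S).prodCongr ((f ^ (-d)).prodCongr (g ^ c))) ^ (m - n)) (s, x, y)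
        = (s, f x, g y) := by
  intro s x y
  have hf' : f ^ m = 1 := hf
  have hg' : g ^ n = 1 := hg
  have h1 : (f ^ (-d)) ^ (m - n) = f := by
    rw [← zpow_mul, show -d * (m - n) = 1 + m * (-c - d) by linear_combination hbezout,
      zpow_add, zpow_mul, hf', one_zpow, zpow_one, mul_one]
  have h2 : (g ^ c) ^ (m - n) = g := by
    rw [← zpow_mul, show c * (m - n) = 1 + n * (-c - d) by linear_combination hbezout,
      zpow_add, zpow_mul, hg', one_zpow, zpow_one, mul_one]
  have h0 : ((Equiv.refl S : Equiv.Perm S)) ^ (m - n) = Equiv.refl S := one_zpow (m - n)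
  rw [prodCongr_zpow_aux, prodCongr_zpow_aux, h0, h1, h2]
  rfl
end

section
/- Let X and Y be topological spaces, let f : X ≃ₜ X and g : Y ≃ₜ Y be homeomorphisms, and let m, n, c, d be integers with f^m = id, g^n = id, and m·c + n·d = 1. Define the homeomorphism h of (ℝ/ℤ) × X × Y by h(θ, x, y) = (θ, f^(-d)(x), g^c(y)). Then M(f) × M(g) is homeomorphic to M(h). -/
/-- The group of self-homeomorphisms of a topological space, with
`(f * g) x = f (g x)`; integer powers are iterates. -/
instance homeomorphGroup {X : Type*} [TopologicalSpace X] : Group (X ≃ₜ X) where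
  mul f g := g.trans f
  one := Homeomorph.refl X
  inv := Homeomorph.symm
  mul_assoc f g h := by ext x; rfl
  one_mul f := by ext x; rfl
  mul_one f := by ext x; rfl
  inv_mul_cancel f := by ext x; exact f.symm_apply_apply x

/-- The orbit relation on `ℝ × X` of the `ℤ`-action `k • (t, x) = (t + k, f^k x)`. -/
def mappingTorusRel {X : Type*} [TopologicalSpace X] (f : X ≃ₜ X) :
    ℝ × X → ℝ × X → Prop :=
  fun p q => ∃ k : ℤ, q = (p.1 + k, (f ^ k) p.2)

/-- The mapping torus of a homeomorphism `f : X ≃ₜ X`: the quotient of `ℝ × X`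
by the `ℤ`-action `k • (t, x) = (t + k, f^k x)`, with the quotient topology. -/
def MappingTorus {X : Type*} [TopologicalSpace X] (f : X ≃ₜ X) : Type _ :=
  Quot (mappingTorusRel f)

instance {X : Type*} [TopologicalSpace X] (f : X ≃ₜ X) :
    TopologicalSpace (MappingTorus f) :=
  inferInstanceAs (TopologicalSpace (Quot (mappingTorusRel f)))

theorem mt_mul_apply {X : Type*} [TopologicalSpace X] (f g : X ≃ₜ X) (x : X) :
    (f * g) x = f (g x) := rfl

theorem mt_one_apply {X : Type*} [TopologicalSpace X] (x : X) :
    (1 : X ≃ₜ X) x = x := rfl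

theorem mt_eq_iff {X : Type*} [TopologicalSpace X] (f : X ≃ₜ X) (p q : ℝ × X) :
    (Quot.mk (mappingTorusRel f) p : MappingTorus f) = Quot.mk (mappingTorusRel f) q ↔
      mappingTorusRel f p q := by
  have he : Equivalence (mappingTorusRel f) := by
    refine ⟨fun p => ⟨0, ?_⟩, ?_, ?_⟩
    · ext <;> simp [mt_one_apply]
    · rintro p q ⟨k, rfl⟩
      refine ⟨-k, ?_⟩
      ext
      · simp
      · simp only []
        rw [← mt_mul_apply, ← zpow_add, neg_add_cancel, zpow_zero, mt_one_apply]
    · rintro p q r ⟨k, rfl⟩ ⟨l, rfl⟩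
      refine ⟨l + k, ?_⟩
      ext
      · simp only []
        push_cast
        ring
      · simp only []
        rw [← mt_mul_apply, ← zpow_add]
  exact Equivalence.quot_mk_eq_iff he p q

theorem mt_isOpenQuotientMap {X : Type*} [TopologicalSpace X] (f : X ≃ₜ X) :
    IsOpenQuotientMap (Quot.mk (mappingTorusRel f) : ℝ × X → MappingTorus f) := by
  have hq : Topology.IsQuotientMap (Quot.mk (mappingTorusRel f) : ℝ × X → MappingTorus f) :=
    isQuotientMap_quot_mk
  refine .of_isOpenMap_isQuotientMap ?_ hq
  intro U hU
  rw [← hq.isOpen_preimage]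
  have : (Quot.mk (mappingTorusRel f) : ℝ × X → MappingTorus f) ⁻¹'
      ((Quot.mk (mappingTorusRel f) : ℝ × X → MappingTorus f) '' U) =
      ⋃ k : ℤ, (fun p : ℝ × X => ((p.1 + k, (f ^ k) p.2) : ℝ × X)) ⁻¹' U := by
    ext p
    simp only [Set.mem_preimage, Set.mem_image, Set.mem_iUnion]
    constructor
    · rintro ⟨q, hq, h⟩
      obtain ⟨k, rfl⟩ := (mt_eq_iff f p q).1 h.symm
      exact ⟨k, hq⟩
    · rintro ⟨k, hk⟩
      exact ⟨_, hk, ((mt_eq_iff f p _).2 ⟨k, rfl⟩).symm⟩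
  rw [this]
  refine isOpen_iUnion fun k => hU.preimage ?_
  have := (f ^ k).continuous
  fun_prop

theorem mt_prodCongr_zpow {X Y : Type*} [TopologicalSpace X] [TopologicalSpace Y]
    (f : X ≃ₜ X) (g : Y ≃ₜ Y) (k : ℤ) :
    (f.prodCongr g) ^ k = (f ^ k).prodCongr (g ^ k) := by
  let φ : (X ≃ₜ X) × (Y ≃ₜ Y) →* (X × Y ≃ₜ X × Y) :=
    { toFun := fun p => p.1.prodCongr p.2
      map_one' := by ext x <;> rfl
      map_mul' := fun a b => by ext x <;> rfl }
  exact (map_zpow φ (f, g) k).symm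

/-- The linear change of coordinates. -/
def mtLin (X Y : Type*) [TopologicalSpace X] [TopologicalSpace Y]
    (m n c d : ℤ) (hb : m * c + n * d = 1) :
    (ℝ × X) × (ℝ × Y) ≃ₜ ℝ × ℝ × X × Y where
  toFun p := (-n * p.1.1 + m * p.2.1, c * p.1.1 + d * p.2.1, p.1.2, p.2.2)
  invFun q := ((-d * q.1 + m * q.2.1, q.2.2.1), (c * q.1 + n * q.2.1, q.2.2.2))
  left_inv p := by
    have hb' : (m * c + n * d : ℝ) = 1 := by exact_mod_cast hb
    ext
    · simp only []
      linear_combination p.1.1 * hb'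
    · rfl
    · simp only []
      linear_combination p.2.1 * hb'
    · rfl
  right_inv q := by
    have hb' : (m * c + n * d : ℝ) = 1 := by exact_mod_cast hb
    ext
    · simp only []
      linear_combination q.1 * hb'
    · simp only []
      linear_combination q.2.1 * hb'
    · rfl
    · rfl
  continuous_toFun := by fun_prop
  continuous_invFun := by fun_prop

theorem mt_circle (a b : ℝ) : (a : AddCircle (1 : ℝ)) = b ↔ ∃ k : ℤ, a = b + k := by
  rw [← sub_eq_zero, ← AddCircle.coe_sub, AddCircle.coe_eq_zero_iff]
  simp only [zsmul_eq_mul, mul_one, eq_sub_iff_add_eq]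
  exact exists_congr fun k => by rw [eq_comm, add_comm]

theorem mt_zpow_eq {G : Type*} [Group G] (f : G) (m a b e : ℤ) (hf : f ^ m = 1)
    (h : a = b + m * e) : f ^ a = f ^ b := by
  rw [h, zpow_add, zpow_mul, hf, one_zpow, mul_one]

theorem mappingTorus_prod_homeomorph_mappingTorus
    {X Y : Type*} [TopologicalSpace X] [TopologicalSpace Y]
    (f : X ≃ₜ X) (g : Y ≃ₜ Y) (m n c d : ℤ)
    (hf : f ^ m = 1) (hg : g ^ n = 1) (hbezout : m * c + n * d = 1) :
    Nonempty (MappingTorus f × MappingTorus g ≃ₜ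
      MappingTorus ((Homeomorph.refl (AddCircle (1 : ℝ))).prodCongr
        ((f ^ (-d)).prodCongr (g ^ c)))) := by
  set h := (Homeomorph.refl (AddCircle (1 : ℝ))).prodCongr ((f ^ (-d)).prodCongr (g ^ c)) with hh
  have hpow : ∀ (k : ℤ) θ x y, (h ^ k) (θ, x, y) = (θ, (f ^ (-d * k)) x, (g ^ (c * k)) y) := by
    intro k θ x y
    rw [hh, mt_prodCongr_zpow, mt_prodCongr_zpow, ← zpow_mul, ← zpow_mul]
    have : (Homeomorph.refl (AddCircle (1 : ℝ))) ^ k = 1 := one_zpow k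
    rw [this]
    rfl
  have hA := (mt_isOpenQuotientMap f).prodMap (mt_isOpenQuotientMap g)
  have hC : IsOpenQuotientMap (fun t : ℝ => (t : AddCircle (1 : ℝ))) :=
    QuotientAddGroup.isOpenQuotientMap_mk
  have hB := (mt_isOpenQuotientMap h).comp
    (((IsOpenQuotientMap.id (X := ℝ)).prodMap (hC.prodMap (IsOpenQuotientMap.id (X := X × Y)))).comp
      (mtLin X Y m n c d hbezout).isOpenQuotientMap)
  let A' : C((ℝ × X) × (ℝ × Y), MappingTorus f × MappingTorus g) := ⟨_, hA.continuous⟩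
  let B' : C((ℝ × X) × (ℝ × Y), MappingTorus h) := ⟨_, hB.continuous⟩
  have hA' : Topology.IsQuotientMap A' := hA.isQuotientMap
  have hB' : Topology.IsQuotientMap B' := hB.isQuotientMap
  have key : Setoid.ker A' = Setoid.ker B' := by
    ext ⟨⟨s, x⟩, ⟨t, y⟩⟩ ⟨⟨s', x'⟩, ⟨t', y'⟩⟩
    rw [Setoid.ker_def, Setoid.ker_def]
    have e1 : A' ((s, x), (t, y)) = A' ((s', x'), (t', y')) ↔
        (∃ k : ℤ, s' = s + k ∧ x' = (f ^ k) x) ∧ (∃ l : ℤ, t' = t + l ∧ y' = (g ^ l) y) := by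
      refine Prod.ext_iff.trans (and_congr ((mt_eq_iff f _ _).trans ?_)
        ((mt_eq_iff g _ _).trans ?_)) <;> simp [mappingTorusRel]
    have e2 : B' ((s, x), (t, y)) = B' ((s', x'), (t', y')) ↔
        ∃ a : ℤ, -n * s' + m * t' = -n * s + m * t + a ∧
          (∃ b : ℤ, c * s' + d * t' = c * s + d * t + b) ∧
          x' = (f ^ (-d * a)) x ∧ y' = (g ^ (c * a)) y := by
      refine (mt_eq_iff h _ _).trans (exists_congr fun a => ?_)
      refine Prod.ext_iff.trans (and_congr Iff.rfl ?_)
      rw [← mt_circle]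
      refine (Eq.congr_right (hpow a _ _ _)).trans ?_
      exact Prod.ext_iff.trans (and_congr Iff.rfl Prod.ext_iff)
    have hb' : (m * c + n * d : ℝ) = 1 := by exact_mod_cast hbezout
    rw [e1, e2]
    constructor
    · rintro ⟨⟨k, rfl, rfl⟩, ⟨l, rfl, rfl⟩⟩
      refine ⟨-n * k + m * l, by push_cast; ring, ⟨c * k + d * l, by push_cast; ring⟩, ?_, ?_⟩
      · rw [mt_zpow_eq f m k (-d * (-n * k + m * l)) (c * k + d * l) hf]
        linear_combination -k * hbezout
      · rw [mt_zpow_eq g n l (c * (-n * k + m * l)) (c * k + d * l) hg]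
        linear_combination -l * hbezout
    · rintro ⟨a, ha, ⟨b, hb⟩, rfl, rfl⟩
      refine ⟨⟨-d * a + m * b, ?_, ?_⟩, ⟨c * a + n * b, ?_, ?_⟩⟩
      · push_cast
        linear_combination (s - s') * hb' - d * ha + m * hb
      · rw [mt_zpow_eq f m _ (-d * a) b hf rfl]
      · push_cast
        linear_combination (t - t') * hb' + c * ha + n * hb
      · rw [mt_zpow_eq g n _ (c * a) b hg rfl]
  have e := hB'.homeomorph
  rw [← key] at e
  exact ⟨hA'.homeomorph.symm.trans e⟩
end

section
/- Let X be a topological space, f : X ≃ₜ X a homeomorphism, and let p : M(f) → ℝ/ℤ be the map induced by (t, x) ↦ t mod ℤ. Then p is well defined, continuous, and a locally trivial fiber bundle with fiber X: every point of ℝ/ℤ has an open neighborhood U together with a homeomorphism p⁻¹(U) ≃ₜ U × X commuting with the projections to U. -/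
theorem mappingTorus_isFiberBundle {X : Type*} [TopologicalSpace X] (f : X ≃ₜ X) :
    ∃ p : MappingTorus f → AddCircle (1 : ℝ),
      (∀ (t : ℝ) (x : X),
        p (Quot.mk (mappingTorusRel f) (t, x)) = ((t : ℝ) : AddCircle (1 : ℝ))) ∧
      Continuous p ∧
      ∀ θ : AddCircle (1 : ℝ), ∃ U : Set (AddCircle (1 : ℝ)), IsOpen U ∧ θ ∈ U ∧
        ∃ e : (p ⁻¹' U) ≃ₜ U × X, ∀ v : p ⁻¹' U, ((e v).1 : AddCircle (1 : ℝ)) = p v := by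
  let p : MappingTorus f → AddCircle (1 : ℝ) :=
    Quot.lift (fun q : ℝ × X => ((q.1 : ℝ) : AddCircle (1 : ℝ))) (by
      rintro ⟨t, x⟩ q ⟨k, rfl⟩
      have h : ((k : ℝ) : AddCircle (1 : ℝ)) = 0 :=
        (AddCircle.coe_eq_zero_iff (1 : ℝ)).2 ⟨k, by simp⟩
      simp [h])
  have hp : Continuous p := by
    exact isQuotientMap_quot_mk.continuous_iff.2 ((AddCircle.continuous_mk' (1 : ℝ)).comp continuous_fst)
  refine ⟨p, fun t x => rfl, hp, fun θ => ?_⟩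
  obtain ⟨s, rfl⟩ := QuotientAddGroup.mk_surjective θ
  let a : ℝ := s - 1 / 2
  have hfr : ∀ t : ℝ, ((AddCircle.equivIco (1 : ℝ) a (t : AddCircle (1 : ℝ)) : ℝ)) = t - ⌊t - a⌋ := by
    intro t
    show toIcoMod _ a t = _
    rw [toIcoMod, toIcoDiv_eq_floor]
    simp
  have hqm : Topology.IsQuotientMap (Quot.mk (mappingTorusRel f) : ℝ × X → MappingTorus f) := isQuotientMap_quot_mk
  let F : MappingTorus f → X :=
    Quot.lift (fun q : ℝ × X => (f ^ (-⌊q.1 - a⌋)) q.2) (by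
      rintro ⟨t, x⟩ q ⟨k, rfl⟩
      have h : t + (k : ℝ) - a = t - a + k := by ring
      show (f ^ (-⌊t - a⌋)) x = (f ^ (-⌊t + (k : ℝ) - a⌋) * f ^ k) x
      rw [h, Int.floor_add_intCast, ← zpow_add]
      congr 2
      ring)
  have hne : ∀ t : ℝ, (t : AddCircle (1 : ℝ)) ≠ (a : AddCircle (1 : ℝ)) → (⌊t - a⌋ : ℝ) < t - a := by
    intro t ht
    refine lt_of_le_of_ne (Int.floor_le _) fun h => ht ?_
    rw [← sub_eq_zero, ← AddCircle.coe_sub, AddCircle.coe_eq_zero_iff]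
    exact ⟨⌊t - a⌋, by simpa using h⟩
  let U : Set (AddCircle (1 : ℝ)) := {(a : AddCircle (1 : ℝ))}ᶜ
  have hU : IsOpen U := isOpen_compl_singleton
  have hF : ContinuousOn F (p ⁻¹' U) := by
    refine (hqm.continuousOn_isOpen_iff (hU.preimage hp)).2 ?_
    rintro ⟨t, x⟩ htx
    have h1 := hne t htx
    have h2 := Int.lt_floor_add_one (t - a)
    apply ContinuousAt.continuousWithinAt
    have hc : ContinuousAt (fun q : ℝ × X => (f ^ (-⌊t - a⌋)) q.2) (t, x) :=
      ((f ^ (-⌊t - a⌋)).continuous.comp continuous_snd).continuousAt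
    refine hc.congr ?_
    have hc1 : ContinuousAt (fun q : ℝ × X => q.1 - a) (t, x) := by fun_prop
    filter_upwards [hc1.eventually (lt_mem_nhds h1), hc1.eventually (gt_mem_nhds h2)] with q h3 h4
    have : ⌊q.1 - a⌋ = ⌊t - a⌋ := Int.floor_eq_iff.2 ⟨h3.le, h4⟩
    show _ = (f ^ (-⌊q.1 - a⌋)) q.2
    rw [this]
  let r : AddCircle (1 : ℝ) → ℝ := fun u => AddCircle.equivIco (1 : ℝ) a u
  have hr : ∀ u, ((r u : ℝ) : AddCircle (1 : ℝ)) = u := fun u =>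
    (AddCircle.equivIco (1 : ℝ) a).symm_apply_apply u
  have hrI : ∀ u, r u ∈ Set.Ico a (a + 1) := fun u => (AddCircle.equivIco (1 : ℝ) a u).2
  refine ⟨U, hU, ?_, ⟨⟨fun v => (⟨p v, v.2⟩, F v),
    fun w => ⟨Quot.mk _ (r w.1, w.2), ?_⟩, ?_, ?_⟩, ?_, ?_⟩, fun v => rfl⟩
  · show ((s : ℝ) : AddCircle (1 : ℝ)) ≠ (a : AddCircle (1 : ℝ))
    intro h
    rw [← sub_eq_zero, ← AddCircle.coe_sub, AddCircle.coe_eq_zero_iff] at h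
    obtain ⟨n, hn⟩ := h
    have h2 : (n : ℝ) * 2 = 1 := by
      simp only [zsmul_eq_mul, a] at hn
      linarith
    have h3 : n * 2 = 1 := by exact_mod_cast h2
    omega
  · show ((r w.1 : ℝ) : AddCircle (1 : ℝ)) ∈ U
    rw [hr]
    exact w.1.2
  · rintro ⟨v, hv⟩
    obtain ⟨⟨t, x⟩, rfl⟩ := hqm.surjective v
    apply Subtype.ext
    refine (Quot.sound ⟨-⌊t - a⌋, ?_⟩).symm
    refine Prod.ext ?_ rfl
    show r (t : AddCircle (1 : ℝ)) = t + ((-⌊t - a⌋ : ℤ) : ℝ)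
    rw [show r (t : AddCircle (1 : ℝ)) = _ from hfr t]
    push_cast
    ring
  · rintro ⟨⟨u, hu⟩, x⟩
    refine Prod.ext (Subtype.ext (hr u)) ?_
    show (f ^ (-⌊r u - a⌋)) x = x
    have h := hrI u
    have : ⌊r u - a⌋ = 0 := Int.floor_eq_iff.2
      ⟨by push_cast; linarith [h.1], by push_cast; linarith [h.2]⟩
    rw [this]
    simp
  · exact (Continuous.subtype_mk (hp.comp continuous_subtype_val) _).prodMk
      (continuousOn_iff_continuous_domRestrict.1 hF)
  · refine Continuous.subtype_mk (hqm.continuous.comp ?_) _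
    have hrc : Continuous (fun u : U => r u) := by
      rw [continuous_iff_continuousAt]
      intro u
      exact (continuous_subtype_val.continuousAt.comp
        (AddCircle.continuousAt_equivIco (1 : ℝ) a u.2)).comp continuous_subtype_val.continuousAt
    exact (hrc.comp continuous_fst).prodMk continuous_snd
end

section
/- Let k ≥ 1 and let A be an invertible k×k real matrix with det A > 0, and let a, b be real numbers with 0 < a < b < 1. Then there exists a smooth (C^∞) map φ : ℝ → Matrix (Fin k) (Fin k) ℝ such that φ(t) is invertible for every t, φ(t) = 1 (the identity matrix) for all t ≤ a, and φ(t) = A for all t ≥ b. -/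
attribute [local instance] Matrix.normedAddCommGroup Matrix.normedSpace

def HasPath (k : ℕ) (a b : ℝ) (A : Matrix (Fin k) (Fin k) ℝ) : Prop :=
  ∃ φ : ℝ → Matrix (Fin k) (Fin k) ℝ,
      ContDiff ℝ (⊤ : ℕ∞) φ ∧
      (∀ t, IsUnit (φ t)) ∧
      (∀ t ≤ a, φ t = 1) ∧
      (∀ t, b ≤ t → φ t = A)

theorem contDiff_matrix {k : ℕ} {φ : ℝ → Matrix (Fin k) (Fin k) ℝ} :
    ContDiff ℝ (⊤ : ℕ∞) φ ↔ ∀ i j, ContDiff ℝ (⊤ : ℕ∞) (fun t => φ t i j) := by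
  constructor
  · intro h i j
    exact contDiff_pi.1 (contDiff_pi.1 h i) j
  · intro h
    exact contDiff_pi.2 fun i => contDiff_pi.2 fun j => h i j

theorem HasPath.mul {k : ℕ} {a b : ℝ} {A B : Matrix (Fin k) (Fin k) ℝ}
    (hA : HasPath k a b A) (hB : HasPath k a b B) : HasPath k a b (A * B) := by
  obtain ⟨f, f1, f2, f3, f4⟩ := hA
  obtain ⟨g, g1, g2, g3, g4⟩ := hB
  refine ⟨fun t => f t * g t, ?_, fun t => (f2 t).mul (g2 t), fun t ht => ?_, fun t ht => ?_⟩
  · rw [contDiff_matrix] at *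
    intro i j
    simp only [Matrix.mul_apply]
    exact ContDiff.sum fun l _ => (f1 i l).mul (g1 l j)
  · simp [f3 t ht, g3 t ht]
  · simp [f4 t ht, g4 t ht]

theorem exists_step {a b : ℝ} (hab : a < b) : ∃ s : ℝ → ℝ, ContDiff ℝ (⊤ : ℕ∞) s ∧
    (∀ t, 0 ≤ s t ∧ s t ≤ 1) ∧ (∀ t ≤ a, s t = 0) ∧ (∀ t, b ≤ t → s t = 1) := by
  refine ⟨fun t => Real.smoothTransition ((t - a) / (b - a)), ?_, fun t => 
    ⟨Real.smoothTransition.nonneg _, Real.smoothTransition.le_one _⟩, fun t ht => ?_, fun t ht => ?_⟩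
  · exact Real.smoothTransition.contDiff.comp (by fun_prop)
  · exact Real.smoothTransition.zero_of_nonpos
      (div_nonpos_of_nonpos_of_nonneg (by linarith) (by linarith))
  · apply Real.smoothTransition.one_of_one_le
    rw [le_div_iff₀ (by linarith)]
    linarith

theorem hasPath_transvection {k : ℕ} {a b : ℝ} (hab : a < b) {i j : Fin k} (hij : i ≠ j) (c : ℝ) :
    HasPath k a b (Matrix.transvection i j c) := by
  obtain ⟨s, s1, s2, s3, s4⟩ := exists_step hab
  refine ⟨fun t => Matrix.transvection i j (s t * c), ?_, fun t => ?_, fun t ht => ?_,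
    fun t ht => ?_⟩
  · rw [contDiff_matrix]
    intro x y
    simp only [Matrix.transvection, Matrix.add_apply, Matrix.single_apply]
    split_ifs <;> fun_prop
  · rw [Matrix.isUnit_iff_isUnit_det, Matrix.det_transvection_of_ne _ _ hij]
    exact isUnit_one
  · simp [s3 t ht]
  · simp [s4 t ht]

theorem hasPath_diag_pos {k : ℕ} {a b : ℝ} (hab : a < b) (d : Fin k → ℝ) (hd : ∀ i, 0 < d i) :
    HasPath k a b (Matrix.diagonal d) := by
  obtain ⟨s, s1, s2, s3, s4⟩ := exists_step hab
  refine ⟨fun t => Matrix.diagonal fun i => (1 - s t) + s t * d i, ?_, fun t => ?_, fun t ht => ?_,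
    fun t ht => ?_⟩
  · rw [contDiff_matrix]
    intro x y
    simp only [Matrix.diagonal_apply]
    split_ifs <;> fun_prop
  · rw [Matrix.isUnit_iff_isUnit_det, Matrix.det_diagonal, isUnit_iff_ne_zero]
    refine (Finset.prod_pos fun i _ => ?_).ne'
    obtain ⟨h0, h1⟩ := s2 t
    rcases h0.eq_or_lt with h | h
    · simp [← h]
    · have := mul_pos h (hd i)
      linarith
  · simp [s3 t ht]
  · simp [s4 t ht]

def flipv {k : ℕ} (i j : Fin k) : Fin k → ℝ :=
  fun y => (if y = i then -1 else 1) * (if y = j then -1 else 1)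

theorem flip_eq {k : ℕ} {i j : Fin k} (hij : i ≠ j) :
    Matrix.diagonal (flipv i j) =
      (Matrix.transvection i j 1 * Matrix.transvection j i (-1) * Matrix.transvection i j 1) *
      (Matrix.transvection i j 1 * Matrix.transvection j i (-1) * Matrix.transvection i j 1) := by
  have h1 : Matrix.diagonal (flipv i j) = 1 - (2:ℝ) • Matrix.single i i (1:ℝ)
      - (2:ℝ) • Matrix.single j j (1:ℝ) := by
    ext x y
    simp only [Matrix.diagonal_apply, flipv, Matrix.sub_apply, Matrix.smul_apply,
      Matrix.single_apply, Matrix.one_apply, smul_eq_mul]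
    by_cases hxy : x = y <;> by_cases hx : x = i <;> by_cases hx' : x = j <;> grind
  have h2 : Matrix.transvection i j (1:ℝ) * Matrix.transvection j i (-1)
      * Matrix.transvection i j 1 = 1 + Matrix.single i j 1 - Matrix.single j i 1
        - Matrix.single i i 1 - Matrix.single j j 1 := by
    have : Matrix.single j i (-1:ℝ) = - Matrix.single j i 1 := by simp [Matrix.single_neg]
    simp only [Matrix.transvection, this, mul_add, add_mul, mul_neg, neg_mul, mul_one, one_mul,
      Matrix.single_mul_single_same, Matrix.single_mul_single_of_ne _ _ _ _ hij,
      Matrix.single_mul_single_of_ne _ _ _ _ hij.symm]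
    abel
  rw [h1, h2]
  simp only [mul_add, add_mul, mul_sub, sub_mul, mul_one, one_mul,
      Matrix.single_mul_single_same, Matrix.single_mul_single_of_ne _ _ _ _ hij,
      Matrix.single_mul_single_of_ne _ _ _ _ hij.symm, two_smul]
  abel

theorem hasPath_flip {k : ℕ} {a b : ℝ} (hab : a < b) {i j : Fin k} (hij : i ≠ j) :
    HasPath k a b (Matrix.diagonal (flipv i j)) := by
  rw [flip_eq hij]
  have h := ((hasPath_transvection hab hij 1).mul (hasPath_transvection hab hij.symm (-1))).mul
    (hasPath_transvection hab hij 1)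
  exact h.mul h

theorem hasPath_diag {k : ℕ} {a b : ℝ} (hab : a < b) (i₀ : Fin k) (S : Finset (Fin k)) :
    ∀ d : Fin k → ℝ, 0 < ∏ i, d i → (∀ i, i ≠ i₀ → i ∉ S → 0 < d i) →
    HasPath k a b (Matrix.diagonal d) := by
  induction S using Finset.induction_on with
  | empty =>
    intro d hd h
    refine hasPath_diag_pos hab d fun i => ?_
    by_cases hi : i = i₀
    · subst hi
      rw [← Finset.mul_prod_erase _ _ (Finset.mem_univ i)] at hd
      refine pos_of_mul_pos_left hd (Finset.prod_nonneg fun j hj => ?_)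
      exact (h j (Finset.ne_of_mem_erase hj) (by simp)).le
    · exact h i hi (by simp)
  | insert x S hx ih =>
    intro d hd h
    by_cases hc : x = i₀ ∨ 0 < d x
    · refine ih d hd fun i hi hiS => ?_
      by_cases hix : i = x
      · subst hix; tauto
      · exact h i hi (by simp [hix, hiS])
    · push Not at hc
      obtain ⟨hx0, hdx⟩ := hc
      have hne : d x ≠ 0 := fun h0 => hd.ne' (Finset.prod_eq_zero (Finset.mem_univ x) h0)
      have e : Matrix.diagonal d = Matrix.diagonal (flipv x i₀) *
          Matrix.diagonal (fun y => flipv x i₀ y * d y) := by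
        rw [Matrix.diagonal_mul_diagonal]
        congr 1
        ext y
        simp only [flipv]
        split_ifs <;> ring
      rw [e]
      refine (hasPath_flip hab hx0).mul (ih _ ?_ fun i hi hiS => ?_)
      · rw [Finset.prod_mul_distrib]
        have h1 : ∏ i, flipv x i₀ i = 1 := by
          unfold flipv
          rw [Finset.prod_mul_distrib]
          simp
        rwa [h1, one_mul]
      · by_cases hix : i = x
        · subst hix
          have := lt_of_le_of_ne hdx hne
          simp [flipv, hi, this]
        · simpa [flipv, hix, hi] using h i hi (by simp [hix, hiS])

theorem hasPath_list {k : ℕ} {a b : ℝ} (hab : a < b)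
    (L : List (Matrix.TransvectionStruct (Fin k) ℝ)) :
    HasPath k a b (L.map Matrix.TransvectionStruct.toMatrix).prod := by
  induction L with
  | nil => exact ⟨fun _ => 1, contDiff_const, fun _ => isUnit_one, fun _ _ => rfl, fun _ _ => rfl⟩
  | cons t L ih =>
    rw [List.map_cons, List.prod_cons]
    exact (hasPath_transvection hab t.hij t.c).mul ih

theorem exists_smooth_path_in_GLpos (k : ℕ) (hk : 1 ≤ k)
    (A : Matrix (Fin k) (Fin k) ℝ) (hA : IsUnit A) (hdet : 0 < A.det)
    (a b : ℝ) (ha : 0 < a) (hab : a < b) (hb1 : b < 1) :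
    ∃ φ : ℝ → Matrix (Fin k) (Fin k) ℝ,
      ContDiff ℝ (⊤ : ℕ∞) φ ∧
      (∀ t, IsUnit (φ t)) ∧
      (∀ t ≤ a, φ t = 1) ∧
      (∀ t, b ≤ t → φ t = A) := by
  obtain ⟨L, L', D, hM⟩ := Matrix.Pivot.exists_list_transvec_mul_diagonal_mul_list_transvec A
  have hD : 0 < ∏ i, D i := by
    rw [hM] at hdet
    simpa using hdet
  have := ((hasPath_list hab L).mul (hasPath_diag hab ⟨0, hk⟩ Finset.univ D hD (by simp))).mul
    (hasPath_list hab L')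
  rw [← hM] at this
  exact this
end

section
/- Let E = ℝⁿ (or a real finite-dimensional normed space), let V₁, …, V_k : E → E be smooth vector fields that pairwise commute (the Lie bracket [V_i, V_j] = 0 for all i, j) and are linearly independent at every point of E, and let ρ : ℝ → ℝ be a smooth function with ρ(t)² ≤ 1 for all t. Define vector fields on ℝ × E by W₁(t, x) = (1 − ρ(t)², ρ(t)·V₁(x)) and W_i(t, x) = (0, V_i(x)) for i = 2, …, k. Then the W_i are smooth, pairwise commute, and are linearly independent at every point of ℝ × E. -/
theorem commuting_frame_flip
    {E : Type*} [NormedAddCommGroup E] [NormedSpace ℝ E] [FiniteDimensional ℝ E]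
    (k : ℕ) (hk : 0 < k) (V : Fin k → E → E)
    (hVsmooth : ∀ i, ContDiff ℝ (⊤ : ℕ∞) (V i))
    (hVcomm : ∀ i j, ∀ x : E,
      fderiv ℝ (V j) x (V i x) - fderiv ℝ (V i) x (V j x) = 0)
    (hVindep : ∀ x : E, LinearIndependent ℝ fun i => V i x)
    (ρ : ℝ → ℝ) (hρsmooth : ContDiff ℝ (⊤ : ℕ∞) ρ) (hρle : ∀ t, ρ t ^ 2 ≤ 1)
    (W : Fin k → ℝ × E → ℝ × E)
    (hW1 : ∀ (t : ℝ) (x : E),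
      W ⟨0, hk⟩ (t, x) = (1 - ρ t ^ 2, ρ t • V ⟨0, hk⟩ x))
    (hWi : ∀ i : Fin k, i ≠ ⟨0, hk⟩ → ∀ (t : ℝ) (x : E),
      W i (t, x) = ((0 : ℝ), V i x)) :
    (∀ i, ContDiff ℝ (⊤ : ℕ∞) (W i)) ∧
    (∀ i j, ∀ p : ℝ × E,
      fderiv ℝ (W j) p (W i p) - fderiv ℝ (W i) p (W j p) = 0) ∧
    (∀ p : ℝ × E, LinearIndependent ℝ fun i => W i p) := by
  have e0 : W ⟨0, hk⟩ = fun p : ℝ × E => (1 - ρ p.1 ^ 2, ρ p.1 • V ⟨0, hk⟩ p.2) := by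
    funext p; exact hW1 p.1 p.2
  have ei : ∀ i : Fin k, i ≠ ⟨0, hk⟩ → W i = fun p : ℝ × E => ((0 : ℝ), V i p.2) := by
    intro i hi; funext p; exact hWi i hi p.1 p.2
  have hVd : ∀ i x, HasFDerivAt (V i) (fderiv ℝ (V i) x) x := fun i x =>
    (((hVsmooth i).differentiable (by simp)) x).hasFDerivAt
  have hρd : ∀ t, HasFDerivAt ρ (fderiv ℝ ρ t) t := fun t =>
    ((hρsmooth.differentiable (by simp)) t).hasFDerivAt
  have hVd2 : ∀ i (p : ℝ × E), HasFDerivAt (fun q : ℝ × E => V i q.2)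
      ((fderiv ℝ (V i) p.2).comp (ContinuousLinearMap.snd ℝ ℝ E)) p := fun i p =>
    (hVd i p.2).comp p hasFDerivAt_snd
  have hρd1 : ∀ (p : ℝ × E), HasFDerivAt (fun q : ℝ × E => ρ q.1)
      ((fderiv ℝ ρ p.1).comp (ContinuousLinearMap.fst ℝ ℝ E)) p := fun p =>
    (hρd p.1).comp p hasFDerivAt_fst
  have di : ∀ i : Fin k, i ≠ ⟨0, hk⟩ → ∀ p v : ℝ × E,
      fderiv ℝ (W i) p v = ((0 : ℝ), fderiv ℝ (V i) p.2 v.2) := by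
    intro i hi p v
    rw [ei i hi, ((hasFDerivAt_const (0 : ℝ) p).prodMk (hVd2 i p)).fderiv]
    simp
  have d0 : ∀ (p : ℝ × E) (v : E),
      fderiv ℝ (W ⟨0, hk⟩) p ((0 : ℝ), v) = ((0 : ℝ), ρ p.1 • fderiv ℝ (V ⟨0, hk⟩) p.2 v) := by
    intro p v
    rw [e0]
    refine (congrArg (fun L => L ((0 : ℝ), v))
      ((((hρd1 p).pow 2).const_sub 1).prodMk ((hρd1 p).smul (hVd2 ⟨0, hk⟩ p))).fderiv).trans ?_
    simp
  have key : ∀ j : Fin k, j ≠ ⟨0, hk⟩ → ∀ p : ℝ × E,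
      fderiv ℝ (W j) p (W ⟨0, hk⟩ p) = fderiv ℝ (W ⟨0, hk⟩) p (W j p) := by
    intro j hj p
    have h := sub_eq_zero.1 (hVcomm ⟨0, hk⟩ j p.2)
    rw [di j hj, ei j hj, d0, e0]
    simp [h]
  refine ⟨?_, ?_, ?_⟩
  · intro i
    have hV2 : ContDiff ℝ (⊤ : ℕ∞) (fun q : ℝ × E => V i q.2) := (hVsmooth i).comp contDiff_snd
    have hr : ContDiff ℝ (⊤ : ℕ∞) (fun q : ℝ × E => ρ q.1) := hρsmooth.comp contDiff_fst
    by_cases hi : i = ⟨0, hk⟩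
    · subst hi
      rw [e0]
      exact (contDiff_const.sub (hr.pow 2)).prodMk (hr.smul hV2)
    · rw [ei i hi]
      exact contDiff_const.prodMk hV2
  · intro i j p
    rw [sub_eq_zero]
    by_cases hi : i = ⟨0, hk⟩
    · by_cases hj : j = ⟨0, hk⟩
      · rw [hi, hj]
      · rw [hi]; exact key j hj p
    · by_cases hj : j = ⟨0, hk⟩
      · rw [hj]; exact (key i hi p).symm
      · rw [di i hi, di j hj, ei i hi, ei j hj]
        have h := sub_eq_zero.1 (hVcomm i j p.2)
        simp [h]
  · intro p
    rw [Fintype.linearIndependent_iff]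
    intro g hg
    have h2 : ∑ i, (g i * (if i = ⟨0, hk⟩ then ρ p.1 else 1)) • V i p.2 = 0 := by
      have := congrArg Prod.snd hg
      rw [Prod.snd_sum] at this
      refine Eq.trans ?_ this
      refine Finset.sum_congr rfl fun i _ => ?_
      by_cases hi : i = ⟨0, hk⟩
      · subst hi
        simp [e0, mul_smul]
      · simp [ei i hi, hi]
    have h3 := Fintype.linearIndependent_iff.1 (hVindep p.2) _ h2
    have h4 : ∀ i, i ≠ ⟨0, hk⟩ → g i = 0 := fun i hi => by simpa [hi] using h3 i
    intro i
    by_cases hi : i = ⟨0, hk⟩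
    · subst hi
      have h5 : g ⟨0, hk⟩ * ρ p.1 = 0 := by simpa using h3 ⟨0, hk⟩
      rw [Finset.sum_eq_single ⟨0, hk⟩ (fun b _ hb => by simp [h4 b hb]) (by simp)] at hg
      have h6 : g ⟨0, hk⟩ * (1 - ρ p.1 ^ 2) = 0 := by
        have := congrArg Prod.fst hg
        rw [e0] at this
        simpa only [Prod.smul_fst, smul_eq_mul, Prod.fst_zero] using this
      linear_combination h6 + ρ p.1 * h5
    · exact h4 i hi
end
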